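/- Let T be a category and P an atomic orbital wide subcategory of T. Then P is left cancellable: for composable morphisms f : A → B and g : B → C of T, if both g and g ∘ f lie in P, then f lies in P. -/

import Mathlib

open CategoryTheory CategoryTheory.Limits

universe u

variable (T : Type u) [SmallCategory T]

/-- The category of presheaves of sets on `T`. -/
abbrev PSh := Tᵒᵖ ⥤ Type u

variable {T}

/-- A morphism of presheaves is a disjoint summand inclusion if together with some
`g : Z ⟶ Y` it exhibits `Y` as a coproduct of `X` and `Z`. -/
def IsDisjointSummandInclusion {X Y : PSh T} (f : X ⟶ Y) : Prop :=
  ∃ (Z : PSh T) (g : Z ⟶ Y), Nonempty (IsColimit (BinaryCofan.mk f g))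

/-- A presheaf is a finite `T`-set if it is isomorphic to a finite coproduct of
representables. -/
def IsFiniteTSet (X : PSh T) : Prop :=
  ∃ (n : ℕ) (A : Fin n → T), Nonempty (X ≅ ∐ fun i => yoneda.obj (A i))

/-- A morphism of presheaves lies in `𝔽^P` if it is isomorphic to a finite disjoint union
of morphisms of the form `(pᵢ)ᵢ : ⨿ᵢ y(Aᵢ) ⟶ y(B)` induced by morphisms `pᵢ : Aᵢ → B`
of `P`. -/
def MemFinP (P : MorphismProperty T) {X Y : PSh T} (f : X ⟶ Y) : Prop :=
  ∃ (n m : ℕ) (A : Fin n → T) (B : Fin m → T) (σ : Fin n → Fin m)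
    (p : ∀ i, A i ⟶ B (σ i)), (∀ i, P (p i)) ∧
    ∃ (eX : X ≅ ∐ fun i => yoneda.obj (A i)) (eY : Y ≅ ∐ fun j => yoneda.obj (B j)),
      f ≫ eY.hom =
        eX.hom ≫ Sigma.desc fun i =>
          yoneda.map (p i) ≫ Sigma.ι (fun j => yoneda.obj (B j)) (σ i)

/-- `P` is a wide subcategory: it contains all isomorphisms and is closed under
composition. -/
def IsWideSubcategory (P : MorphismProperty T) : Prop :=
  (∀ {A B : T} (f : A ⟶ B), IsIso f → P f) ∧
  (∀ {A B C : T} (f : A ⟶ B) (g : B ⟶ C), P f → P g → P (f ≫ g))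

/-- `P` is orbital: base changes of morphisms in `𝔽^P` along morphisms of finite `T`-sets
again lie in `𝔽^P`. -/
def IsOrbital (P : MorphismProperty T) : Prop :=
  ∀ {X Y Z : PSh T} (f : X ⟶ Z) (g : Y ⟶ Z), MemFinP P f → IsFiniteTSet Y →
    MemFinP P (pullback.snd f g)

/-- `P` is atomic orbital: it is orbital and the diagonal of `y(p)` is a disjoint summand
inclusion for every `p` in `P`. -/
def IsAtomicOrbital (P : MorphismProperty T) : Prop :=
  IsOrbital P ∧
    ∀ {A B : T} (p : A ⟶ B), P p → IsDisjointSummandInclusion (pullback.diagonal (yoneda.map p))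

theorem exists_lift_of_isColimit {J : Type} [SmallCategory J] {F : J ⥤ PSh T} {c : Cocone F}
    (hc : IsColimit c) {U : T} (x : yoneda.obj U ⟶ c.pt) :
    ∃ (j : J) (y : yoneda.obj U ⟶ F.obj j), y ≫ c.ι.app j = x := by
  obtain ⟨j, y, hy⟩ := Types.jointly_surjective_of_isColimit
    (isColimitOfPreserves ((evaluation _ _).obj (Opposite.op U)) hc) (yonedaEquiv x)
  refine ⟨j, yonedaEquiv.symm y, ?_⟩
  apply yonedaEquiv.injective
  rw [yonedaEquiv_comp, Equiv.apply_symm_apply]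
  exact hy

theorem exists_lift_sigma {n : ℕ} (D : Fin n → T) {U : T}
    (x : yoneda.obj U ⟶ ∐ fun i => yoneda.obj (D i)) :
    ∃ (i : Fin n) (a : U ⟶ D i), yoneda.map a ≫ Sigma.ι (fun i => yoneda.obj (D i)) i = x := by
  obtain ⟨⟨i⟩, y, hy⟩ := exists_lift_of_isColimit (colimit.isColimit _) x
  obtain ⟨a, rfl⟩ := yoneda.map_surjective y
  exact ⟨i, a, hy⟩

/-- Explicit disjoint union. -/
def sigPSh {n : ℕ} (D : Fin n → T) : PSh T where
  obj U := Σ i, (U.unop ⟶ D i)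
  map f := ↾fun x => ⟨x.1, f.unop ≫ x.2⟩

/-- Explicit inclusion. -/
def sigι {n : ℕ} (D : Fin n → T) (i : Fin n) : yoneda.obj (D i) ⟶ sigPSh D where
  app U := ↾fun x => ⟨i, x⟩

theorem sigma_inj {n : ℕ} (D : Fin n → T) {U : T} {i j : Fin n} (a : U ⟶ D i) (b : U ⟶ D j)
    (h : yoneda.map a ≫ Sigma.ι (fun i => yoneda.obj (D i)) i =
      yoneda.map b ≫ Sigma.ι (fun i => yoneda.obj (D i)) j) :
    (⟨i, a⟩ : Σ i, (U ⟶ D i)) = ⟨j, b⟩ := by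
  have h2 := congrArg (fun t => t ≫ Sigma.desc (sigι D)) h
  simp only [Category.assoc, Sigma.ι_desc] at h2
  have h3 := congrArg yonedaEquiv h2
  rw [yonedaEquiv_comp, yonedaEquiv_comp, yonedaEquiv_yoneda_map, yonedaEquiv_yoneda_map] at h3
  exact h3

theorem summand_lift {X Y : PSh T} {f : X ⟶ Y} (hf : IsDisjointSummandInclusion f)
    {A D : T} (a : A ⟶ D) (y : yoneda.obj D ⟶ Y) (x : yoneda.obj A ⟶ X)
    (h : yoneda.map a ≫ y = x ≫ f) : ∃ z, z ≫ f = y := by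
  obtain ⟨Z, g, ⟨hc⟩⟩ := hf
  obtain ⟨⟨_ | _⟩, z, hz⟩ := exists_lift_of_isColimit hc y
  · exact ⟨z, hz⟩
  · exfalso
    let Ω : PSh T := (Functor.const _).obj (ULift Bool)
    let t : X ⟶ Ω := { app := fun _ => ↾fun _ => ⟨true⟩ }
    let t' : Z ⟶ Ω := { app := fun _ => ↾fun _ => ⟨false⟩ }
    obtain ⟨χ, h1, h2⟩ : ∃ χ : Y ⟶ Ω, f ≫ χ = t ∧ g ≫ χ = t' := by
      obtain ⟨χ, h1, h2⟩ := BinaryCofan.IsColimit.desc' hc t t'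
      exact ⟨χ, h1, h2⟩
    change yoneda.obj D ⟶ Z at z
    replace hz : z ≫ g = y := hz
    have h3 : yoneda.map a ≫ z ≫ t' = x ≫ t := by
      rw [← h1, ← h2, ← Category.assoc z, hz, ← Category.assoc, h, Category.assoc]
    have h4 := congrArg yonedaEquiv h3
    have h5 : (⟨false⟩ : ULift Bool) = ⟨true⟩ := h4
    simp at h5

/-- A representable as a one-term coproduct. -/
noncomputable def oneIso (A : T) : yoneda.obj A ≅ ∐ fun _ : Fin 1 => yoneda.obj A where
  hom := Sigma.ι (fun _ : Fin 1 => yoneda.obj A) 0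
  inv := Sigma.desc fun _ => 𝟙 _
  hom_inv_id := by simp
  inv_hom_id := by
    apply Sigma.hom_ext
    intro i
    obtain rfl := Subsingleton.elim i 0
    simp

theorem memFinP_yoneda (P : MorphismProperty T) {A B : T} (p : A ⟶ B) (hp : P p) :
    MemFinP P (yoneda.map p) :=
  ⟨1, 1, fun _ => A, fun _ => B, id, fun _ => p, fun _ => hp, oneIso A, oneIso B, by
    simp [oneIso]⟩

/-!
Statement 7: every atomic orbital wide subcategory `P` of `T` is left cancellable: if `g`
and `g ∘ f` lie in `P`, then so does `f`.
-/

theorem left_cancellable_of_isAtomicOrbital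
    {T : Type u} [SmallCategory T] (P : MorphismProperty T)
    (hwide : IsWideSubcategory P) (hatomic : IsAtomicOrbital P) :
    ∀ {A B C : T} (f : A ⟶ B) (g : B ⟶ C), P g → P (f ≫ g) → P f := by
  intro A B C f g hg hfg
  obtain ⟨n, m, D, E, σ, p, hp, eX, eY, he⟩ :=
    hatomic.1 (yoneda.map (f ≫ g)) (yoneda.map g) (memFinP_yoneda P _ hfg) ⟨1, _, ⟨oneIso B⟩⟩
  have hw0 : 𝟙 _ ≫ yoneda.map (f ≫ g) = yoneda.map f ≫ yoneda.map g := by simp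
  obtain ⟨w, hw1, hw2⟩ : ∃ w : yoneda.obj A ⟶ pullback (yoneda.map (f ≫ g)) (yoneda.map g),
      w ≫ pullback.fst _ _ = 𝟙 _ ∧ w ≫ pullback.snd _ _ = yoneda.map f :=
    ⟨pullback.lift _ _ hw0, pullback.lift_fst _ _ hw0, pullback.lift_snd _ _ hw0⟩
  obtain ⟨i, a, ha⟩ := exists_lift_sigma D (w ≫ eX.hom)
  obtain ⟨x, hx⟩ : ∃ x : yoneda.obj (D i) ⟶ pullback (yoneda.map (f ≫ g)) (yoneda.map g),
      x ≫ eX.hom = Sigma.ι (fun i => yoneda.obj (D i)) i :=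
    ⟨Sigma.ι (fun i => yoneda.obj (D i)) i ≫ eX.inv, by simp⟩
  have hax : yoneda.map a ≫ x = w := by
    rw [← cancel_mono eX.hom, Category.assoc, hx, ha]
  obtain ⟨u, hu⟩ := yoneda.map_surjective (x ≫ pullback.fst _ _)
  obtain ⟨v, hv⟩ := yoneda.map_surjective (x ≫ pullback.snd _ _)
  have huv : u ≫ f ≫ g = v ≫ g := by
    apply yoneda.map_injective
    rw [yoneda.map_comp, hu, yoneda.map_comp v, hv, Category.assoc, Category.assoc,
      pullback.condition]
  have hau : a ≫ u = 𝟙 A := by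
    apply yoneda.map_injective
    rw [yoneda.map_comp, hu, ← Category.assoc, hax, hw1, yoneda.map_id]
  have hav : a ≫ v = f := by
    apply yoneda.map_injective
    rw [yoneda.map_comp, hv, ← Category.assoc, hax, hw2]
  have huf : u ≫ f = v := by
    obtain ⟨z, hz⟩ := summand_lift (hatomic.2 g hg) a
      (pullback.lift (yoneda.map (u ≫ f)) (yoneda.map v)
        (by rw [← yoneda.map_comp, ← yoneda.map_comp, Category.assoc, huv])) (yoneda.map f)
      (by
        apply pullback.hom_ext
        · simp only [Category.assoc, pullback.lift_fst, pullback.diagonal_fst, Category.comp_id,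
            ← yoneda.map_comp]
          rw [← Category.assoc, hau, Category.id_comp]
        · simp only [Category.assoc, pullback.lift_snd, pullback.diagonal_snd, Category.comp_id,
            ← yoneda.map_comp]
          rw [hav])
    apply yoneda.map_injective
    have h1 := congrArg (fun t => t ≫ pullback.fst _ _) hz
    have h2 := congrArg (fun t => t ≫ pullback.snd _ _) hz
    simp only [Category.assoc, pullback.lift_fst, pullback.diagonal_fst, Category.comp_id] at h1
    simp only [Category.assoc, pullback.lift_snd, pullback.diagonal_snd, Category.comp_id] at h2
    rw [← h1, h2]
  have hxw : yoneda.map u ≫ w = x := by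
    apply pullback.hom_ext
    · rw [← hu, Category.assoc, hw1, Category.comp_id]
    · rw [← hv, ← huf, Category.assoc, hw2, yoneda.map_comp]
  have hua : u ≫ a = 𝟙 _ := by
    have := sigma_inj D (u ≫ a) (𝟙 (D i)) (by
      rw [yoneda.map_comp, Category.assoc, ha, ← Category.assoc, hxw, hx]; simp)
    simpa using this
  have hPa : P a := hwide.1 a ⟨u, hau, hua⟩
  obtain ⟨j, b, hb⟩ := exists_lift_sigma E eY.hom
  have hvp : yoneda.map (v ≫ b) ≫ Sigma.ι (fun i => yoneda.obj (E i)) j =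
      yoneda.map (p i) ≫ Sigma.ι (fun i => yoneda.obj (E i)) (σ i) := by
    rw [yoneda.map_comp, Category.assoc, hb, hv, Category.assoc, he, ← Category.assoc, hx]
    simp
  have hPvb : P (v ≫ b) := by
    have h := sigma_inj E _ _ hvp
    have key : ∀ s : (Σ k, (D i ⟶ E k)), s = ⟨σ i, p i⟩ → P s.2 := by
      rintro _ rfl
      exact hp i
    exact key _ h
  obtain ⟨c, hc⟩ := yoneda.map_surjective (Sigma.ι (fun i => yoneda.obj (E i)) j ≫ eY.inv)
  have hbc : b ≫ c = 𝟙 _ := by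
    apply yoneda.map_injective
    rw [yoneda.map_comp, hc, ← Category.assoc, hb]
    simp
  have hcb : c ≫ b = 𝟙 _ := by
    have := sigma_inj E (c ≫ b) (𝟙 (E j)) (by
      rw [yoneda.map_comp, Category.assoc, hb, hc]; simp)
    simpa using this
  have hPc : P c := hwide.1 c ⟨b, hcb, hbc⟩
  have hfin := hwide.2 _ _ hPa (hwide.2 _ _ hPvb hPc)
  rwa [Category.assoc, hbc, Category.comp_id, hav] at hfin
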